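/- Let c₀, c₁ ∈ ℂ and H ∈ ℝ. A twice continuously differentiable function w : [0,∞) → ℂ satisfies w''(η) + i·w(η) = −2·H·c₀·e^{−αη} for all η ≥ 0, w'(0) = c₁, and w(η) → 0 as η → ∞, if and only if w(η) = ( −c₁/α + H·c₀/α² + η·H·c₀/α )·e^{−αη} for all η ≥ 0. In particular such a decaying solution exists and is unique. -/

import Mathlib

open MeasureTheory Filter Real

/-- `α = √2/2 − i·√2/2`, so `α² = −i` and `Re α = √2/2 > 0`. -/
noncomputable def α : ℂ := (Real.sqrt 2 / 2 : ℝ) - Complex.I * (Real.sqrt 2 / 2 : ℝ)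

theorem alpha_sq : α ^ 2 = -Complex.I := by
  have h : ((√2 : ℝ) : ℂ) ^ 2 = 2 := by
    rw [← Complex.ofReal_pow, Real.sq_sqrt (by norm_num)]
    norm_num
  unfold α
  push_cast
  linear_combination (1 / 4 - Complex.I / 2 + Complex.I ^ 2 / 4) * h + (1 / 2) * Complex.I_sq

theorem alpha_re_pos : 0 < α.re := by
  simp [α]

theorem hasDerivAt_cexp_mul_ofReal (a : ℂ) (x : ℝ) :
    HasDerivAt (fun y : ℝ => Complex.exp (a * y)) (a * Complex.exp (a * x)) x := by
  have h := ((Complex.ofRealCLM.hasDerivAt (x := x)).const_mul a).cexp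
  simpa [mul_comm] using h

theorem hasDerivAt_affine_mul_cexp (a A B : ℂ) (x : ℝ) :
    HasDerivAt (fun y : ℝ => (A + y * B) * Complex.exp (-a * y))
      (((B - a * A) + x * (-a * B)) * Complex.exp (-a * x)) x := by
  have h : HasDerivAt (fun y : ℝ => A + (y : ℂ) * B) B x := by
    simpa using ((Complex.ofRealCLM.hasDerivAt (x := x)).mul_const B).const_add A
  exact (h.mul (hasDerivAt_cexp_mul_ofReal (-a) x)).congr_deriv (by ring)

theorem tendsto_affine_mul_cexp {a : ℂ} (ha : 0 < a.re) (A B : ℂ) :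
    Tendsto (fun y : ℝ => (A + y * B) * Complex.exp (-a * y)) atTop (nhds 0) := by
  have h₀ : Tendsto (fun y : ℝ => Complex.exp (-a * y)) atTop (nhds 0) := by
    rw [tendsto_zero_iff_norm_tendsto_zero]
    simpa [Complex.norm_exp] using tendsto_rpow_mul_exp_neg_mul_atTop_nhds_zero 0 a.re ha
  have h₁ : Tendsto (fun y : ℝ => (y : ℂ) * Complex.exp (-a * y)) atTop (nhds 0) := by
    rw [tendsto_zero_iff_norm_tendsto_zero]
    refine (tendsto_rpow_mul_exp_neg_mul_atTop_nhds_zero 1 a.re ha).congr' ?_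
    filter_upwards [eventually_ge_atTop 0] with y hy
    simp [Complex.norm_exp, abs_of_nonneg hy]
  have h := (h₀.const_mul A).add (h₁.const_mul B)
  simp only [mul_zero, add_zero] at h
  exact h.congr fun y => by ring

/-- Solutions of `p' = a p` on `[0,∞)` are exponentials. -/
theorem eq_mul_cexp_of_hasDerivWithinAt {p : ℝ → ℂ} {a : ℂ}
    (hp : ∀ x ∈ Set.Ici (0 : ℝ), HasDerivWithinAt p (a * p x) (Set.Ici 0) x)
    {x : ℝ} (hx : x ∈ Set.Ici (0 : ℝ)) : p x = p 0 * Complex.exp (a * x) := by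
  have hd : ∀ y ∈ Set.Ici (0 : ℝ),
      HasDerivWithinAt (fun y : ℝ => p y * Complex.exp (-a * y)) 0 (Set.Ici 0) y := by
    intro y hy
    exact ((hp y hy).mul (hasDerivAt_cexp_mul_ofReal (-a) y).hasDerivWithinAt).congr_deriv
      (by ring)
  have h := (convex_Ici (0 : ℝ)).norm_image_sub_le_of_norm_hasDerivWithin_le (C := 0) hd
    (by simp) Set.self_mem_Ici hx
  simp only [zero_mul, norm_le_zero_iff, sub_eq_zero] at h
  have he : Complex.exp (-a * x) * Complex.exp (a * x) = 1 := by
    rw [← Complex.exp_add]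
    simp
  calc p x = p x * Complex.exp (-a * x) * Complex.exp (a * x) := by rw [mul_assoc, he, mul_one]
    _ = p 0 * Complex.exp (a * x) := by rw [h]; simp

/-- A solution of `u'' = a² u` on `[0,∞)` with `u'(0) = 0` that tends to `0` vanishes. -/
theorem eq_zero_of_tendsto_zero {u v : ℝ → ℂ} {a : ℂ} (ha : 0 < a.re)
    (hu : ∀ x ∈ Set.Ici (0 : ℝ), HasDerivWithinAt u (v x) (Set.Ici 0) x)
    (hv : ∀ x ∈ Set.Ici (0 : ℝ), HasDerivWithinAt v (a ^ 2 * u x) (Set.Ici 0) x)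
    (h0 : v 0 = 0) (hlim : Tendsto u atTop (nhds 0)) {x : ℝ} (hx : x ∈ Set.Ici (0 : ℝ)) :
    u x = 0 := by
  have ha0 : a ≠ 0 := by
    rintro rfl
    simp at ha
  have hform : ∀ y ∈ Set.Ici (0 : ℝ),
      2 * u y = u 0 * (Complex.exp (a * y) + Complex.exp (-a * y)) := by
    intro y hy
    have hp := eq_mul_cexp_of_hasDerivWithinAt (p := fun y => v y + a * u y) (a := a)
      (fun z hz => ((hv z hz).add ((hu z hz).const_mul a)).congr_deriv (by ring)) hy
    have hq := eq_mul_cexp_of_hasDerivWithinAt (p := fun y => v y - a * u y) (a := -a)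
      (fun z hz => ((hv z hz).sub ((hu z hz).const_mul a)).congr_deriv (by ring)) hy
    simp only [h0] at hp hq
    apply mul_left_cancel₀ ha0
    linear_combination hp - hq
  have he : Tendsto (fun y : ℝ => Complex.exp (-a * y)) atTop (nhds 0) := by
    simpa using tendsto_affine_mul_cexp ha 1 0
  have hu0 : u 0 = 0 := by
    have h₁ : Tendsto (fun y : ℝ => 2 * u y * Complex.exp (-a * y)) atTop (nhds 0) := by
      simpa using (hlim.const_mul 2).mul he
    have h₂ : Tendsto (fun y : ℝ => 2 * u y * Complex.exp (-a * y)) atTop (nhds (u 0)) := by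
      have h := ((he.mul he).const_add 1).const_mul (u 0)
      simp only [mul_zero, add_zero, mul_one] at h
      refine h.congr' ?_
      filter_upwards [eventually_ge_atTop 0] with y hy
      have hexp : Complex.exp (a * y) * Complex.exp (-a * y) = 1 := by
        rw [← Complex.exp_add]
        simp
      rw [hform y hy]
      linear_combination -u 0 * hexp
    exact tendsto_nhds_unique h₂ h₁
  simpa [hu0] using hform x hx

/-- Let `c₀, c₁ ∈ ℂ` and `H ∈ ℝ`.  A twice continuously differentiable function
`w : [0,∞) → ℂ` satisfies `w''(η) + i·w(η) = −2·H·c₀·e^{−αη}` on `[0,∞)`, `w'(0) = c₁`, and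
`w(η) → 0` as `η → ∞`, if and only if
`w(η) = (−c₁/α + H·c₀/α² + η·H·c₀/α)·e^{−αη}` for all `η ≥ 0`.
In particular such a decaying solution exists and is unique. -/
theorem stmt5 (c₀ c₁ : ℂ) (H : ℝ) (w : ℝ → ℂ) (hw : ContDiffOn ℝ 2 w (Set.Ici (0:ℝ))) :
    ((∀ η ∈ Set.Ici (0:ℝ),
        iteratedDerivWithin 2 w (Set.Ici (0:ℝ)) η + Complex.I * w η
          = -2 * (H : ℂ) * c₀ * Complex.exp (-α * η)) ∧
      derivWithin w (Set.Ici (0:ℝ)) 0 = c₁ ∧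
      Tendsto w atTop (nhds 0))
    ↔ ∀ η ∈ Set.Ici (0:ℝ),
        w η = (-(c₁ / α) + (H : ℂ) * c₀ / α ^ 2 + (η : ℂ) * (H : ℂ) * c₀ / α)
          * Complex.exp (-α * η) := by
  have ha0 : α ≠ 0 := by
    intro h
    simpa [h] using alpha_re_pos
  have hs : UniqueDiffOn ℝ (Set.Ici (0 : ℝ)) := uniqueDiffOn_Ici 0
  set A : ℂ := -(c₁ / α) + (H : ℂ) * c₀ / α ^ 2 with hA
  set B : ℂ := (H : ℂ) * c₀ / α with hB
  have hBα : α * B = H * c₀ := by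
    rw [hB]
    field_simp
  have hslope : B - α * A = c₁ := by
    rw [hA, hB]
    field_simp
    ring
  have hrw : ∀ η : ℝ, (A + (η : ℂ) * (H : ℂ) * c₀ / α) * Complex.exp (-α * η)
      = (A + η * B) * Complex.exp (-α * η) := fun η => by
    rw [hB]
    ring
  simp only [hrw]
  have hf := hasDerivAt_affine_mul_cexp α A B
  have hf' := hasDerivAt_affine_mul_cexp α (B - α * A) (-α * B)
  have hflim := tendsto_affine_mul_cexp alpha_re_pos A B
  constructor
  · rintro ⟨hode, hw0, hlim⟩ η hη
    have hw' : ∀ x ∈ Set.Ici (0 : ℝ),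
        HasDerivWithinAt w (derivWithin w (Set.Ici 0) x) (Set.Ici 0) x := fun x hx =>
      (hw.differentiableOn (by norm_num) x hx).hasDerivWithinAt
    have hw'' : ∀ x ∈ Set.Ici (0 : ℝ), HasDerivWithinAt (derivWithin w (Set.Ici 0))
        (iteratedDerivWithin 2 w (Set.Ici 0) x) (Set.Ici 0) x := by
      intro x hx
      have hd := hw.differentiableOn_iteratedDerivWithin (m := 1) (by norm_num) hs x hx
      rw [iteratedDerivWithin_succ]
      rw [iteratedDerivWithin_one] at hd ⊢
      exact hd.hasDerivWithinAt
    refine sub_eq_zero.mp (eq_zero_of_tendsto_zero alpha_re_pos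
      (u := fun y : ℝ => w y - (A + y * B) * Complex.exp (-α * y))
      (fun x hx => (hw' x hx).sub (hf x).hasDerivWithinAt) (fun x hx => ?_) ?_ ?_ hη)
    · refine ((hw'' x hx).sub (hf' x).hasDerivWithinAt).congr_deriv ?_
      linear_combination hode x hx - w x * alpha_sq + 2 * Complex.exp (-α * x) * hBα
    · simp [hw0, hslope]
    · simpa using hlim.sub hflim
  · intro h
    have hw' : Set.EqOn (derivWithin w (Set.Ici 0))
        (fun x : ℝ => ((B - α * A) + x * (-α * B)) * Complex.exp (-α * x)) (Set.Ici 0) :=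
      fun x hx => ((hf x).hasDerivWithinAt.congr h (h x hx)).derivWithin (hs x hx)
    refine ⟨fun x hx => ?_, ?_, ?_⟩
    · have hw'' := ((hf' x).hasDerivWithinAt.congr hw' (hw' hx)).derivWithin (hs x hx)
      rw [iteratedDerivWithin_succ, iteratedDerivWithin_one, hw'', h x hx]
      linear_combination (A + x * B) * Complex.exp (-α * x) * alpha_sq
        - 2 * Complex.exp (-α * x) * hBα
    · simpa [hslope] using hw' (Set.self_mem_Ici (a := (0 : ℝ)))
    · refine hflim.congr' ?_
      filter_upwards [eventually_ge_atTop 0] with x hx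
      exact (h x hx).symm
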